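/- For all τ ∈ ℂ with Im τ > 0, θ'[0; 1/3](0,τ) · θ[0; 1/3](0,τ)² = −(π/3) · θ[1/2; 0](0,τ) · θ[0; 1/2](0,τ) · θ[1/2; 1/6](0,τ)³, where in [ε'; ε] the first entry is the top characteristic ε' and the second is the bottom characteristic ε. -/

import Mathlib

open Complex

/-- The theta function with characteristic `[ε'; ε]`:
`θ[ε';ε](z,τ) = Σ_{n∈ℤ} exp(πi(n+ε')²τ + 2πi(n+ε')(z+ε))`. -/
noncomputable def jacobiThetaChar (ε' ε : ℝ) (z τ : ℂ) : ℂ :=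
  ∑' n : ℤ, Complex.exp ((Real.pi : ℂ) * Complex.I * ((n : ℂ) + (ε' : ℂ)) ^ 2 * τ +
    2 * (Real.pi : ℂ) * Complex.I * ((n : ℂ) + (ε' : ℂ)) * (z + (ε : ℂ)))

/-- The theta derivative `θ'[ε';ε](0,τ) = ∂_z θ[ε';ε](z,τ) |_{z=0}`. -/
noncomputable def jacobiThetaCharDeriv (ε' ε : ℝ) (τ : ℂ) : ℂ :=
  deriv (fun z => jacobiThetaChar ε' ε z τ) 0


/-- Auxiliary: the series `θ[1/2;0](z,τ)` written through Mathlib's theta function. -/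
noncomputable def thB (z τ : ℂ) : ℂ :=
  cexp (Real.pi * I * τ / 4 + Real.pi * I * z) * jacobiTheta₂ (z + τ / 2) τ

lemma char_zero (ε : ℝ) (z τ : ℂ) : jacobiThetaChar 0 ε z τ = jacobiTheta₂ (z + ε) τ := by
  unfold jacobiThetaChar jacobiTheta₂ jacobiTheta₂_term
  refine tsum_congr fun n => ?_
  congr 1
  push_cast
  ring

lemma char_half (ε : ℝ) (z τ : ℂ) : jacobiThetaChar (1 / 2) ε z τ = thB (z + ε) τ := by
  unfold jacobiThetaChar thB jacobiTheta₂ jacobiTheta₂_term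
  rw [← tsum_mul_left]
  refine tsum_congr fun n => ?_
  rw [← Complex.exp_add]
  congr 1
  push_cast
  ring

lemma th_shift (z τ : ℂ) : jacobiTheta₂ (z + τ / 2) τ =
    cexp (-(Real.pi * I * τ / 4 + Real.pi * I * z)) * thB z τ := by
  unfold thB
  rw [← mul_assoc, ← Complex.exp_add]
  simp

lemma thB_neg (z τ : ℂ) : thB (-z) τ = thB z τ := by
  unfold thB
  rw [show z + τ / 2 = (z - τ / 2) + τ by ring, jacobiTheta₂_add_left', ← mul_assoc,
    ← Complex.exp_add, show -z + τ / 2 = -(z - τ / 2) by ring, jacobiTheta₂_neg_left]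
  congr 2
  ring

lemma thB_shift (z τ : ℂ) : thB (z + τ / 2) τ =
    cexp (-(Real.pi * I * τ / 4 + Real.pi * I * z)) * jacobiTheta₂ z τ := by
  unfold thB
  rw [show z + τ / 2 + τ / 2 = z + τ by ring, jacobiTheta₂_add_left', ← mul_assoc,
    ← Complex.exp_add]
  congr 2
  ring

lemma thB_add_one (z τ : ℂ) : thB (z + 1) τ = - thB z τ := by
  unfold thB
  rw [show z + 1 + τ / 2 = z + τ / 2 + 1 by ring, jacobiTheta₂_add_left,
    show Real.pi * I * τ / 4 + Real.pi * I * (z + 1) =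
      Real.pi * I * τ / 4 + Real.pi * I * z + Real.pi * I by ring, Complex.exp_add _ (Real.pi * I),
    Complex.exp_pi_mul_I]
  ring

/-- splitting pairs of integers by parity of the sum -/
def parMap : (ℤ × ℤ) ⊕ (ℤ × ℤ) → ℤ × ℤ :=
  Sum.elim (fun p => (p.1 + p.2, p.1 - p.2)) (fun p => (p.1 + p.2 + 1, p.1 - p.2))

lemma parMap_bij : Function.Bijective parMap := by
  constructor
  · rintro (⟨a, b⟩ | ⟨a, b⟩) (⟨c, d⟩ | ⟨c, d⟩) h <;>
      simp only [parMap, Sum.elim_inl, Sum.elim_inr, Prod.mk.injEq] at h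
    · have : a = c ∧ b = d := by omega
      simp [this]
    · omega
    · omega
    · have : a = c ∧ b = d := by omega
      simp [this]
  · rintro ⟨m, n⟩
    rcases Int.even_or_odd (m + n) with h | h
    · refine ⟨Sum.inl ((m + n) / 2, (m - n) / 2), ?_⟩
      simp only [parMap, Sum.elim_inl, Prod.mk.injEq]
      rcases h with ⟨k, hk⟩
      omega
    · refine ⟨Sum.inr ((m + n - 1) / 2, (m - n - 1) / 2), ?_⟩
      simp only [parMap, Sum.elim_inr, Prod.mk.injEq]
      rcases h with ⟨k, hk⟩
      omega

lemma two_mul_im_pos {τ : ℂ} (hτ : 0 < τ.im) : 0 < (2 * τ).im := by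
  simpa using hτ

lemma th_summable (z : ℂ) {τ : ℂ} (hτ : 0 < τ.im) :
    Summable fun n => ‖jacobiTheta₂_term n z τ‖ :=
  ((summable_jacobiTheta₂_term_iff z τ).2 hτ).norm

lemma th_mul (x y : ℂ) {τ : ℂ} (hτ : 0 < τ.im) :
    jacobiTheta₂ (x + y) τ * jacobiTheta₂ (x - y) τ =
      jacobiTheta₂ (2 * x) (2 * τ) * jacobiTheta₂ (2 * y) (2 * τ) +
        thB (2 * x) (2 * τ) * thB (2 * y) (2 * τ) := by
  have hτ2 := two_mul_im_pos hτ
  have hs := summable_mul_of_summable_norm (th_summable (x + y) hτ) (th_summable (x - y) hτ)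
  have hs' := (Equiv.ofBijective _ parMap_bij).summable_iff.2 hs
  have e1 : jacobiTheta₂ (2 * x) (2 * τ) * jacobiTheta₂ (2 * y) (2 * τ) =
      ∑' p : ℤ × ℤ, jacobiTheta₂_term (p.1 + p.2) (x + y) τ *
        jacobiTheta₂_term (p.1 - p.2) (x - y) τ := by
    unfold jacobiTheta₂
    rw [tsum_mul_tsum_of_summable_norm (th_summable _ hτ2) (th_summable _ hτ2)]
    refine tsum_congr fun p => ?_
    unfold jacobiTheta₂_term
    rw [← Complex.exp_add, ← Complex.exp_add]
    congr 1
    push_cast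
    ring
  have e2 : thB (2 * x) (2 * τ) * thB (2 * y) (2 * τ) =
      ∑' p : ℤ × ℤ, jacobiTheta₂_term (p.1 + p.2 + 1) (x + y) τ *
        jacobiTheta₂_term (p.1 - p.2) (x - y) τ := by
    unfold thB jacobiTheta₂
    rw [mul_mul_mul_comm,
      tsum_mul_tsum_of_summable_norm (th_summable _ hτ2) (th_summable _ hτ2), ← tsum_mul_left]
    refine tsum_congr fun p => ?_
    unfold jacobiTheta₂_term
    rw [← Complex.exp_add, ← Complex.exp_add, ← Complex.exp_add, ← Complex.exp_add]
    congr 1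
    push_cast
    ring
  rw [e1, e2]
  unfold jacobiTheta₂
  rw [tsum_mul_tsum_of_summable_norm (th_summable _ hτ) (th_summable _ hτ),
    ← (Equiv.ofBijective _ parMap_bij).tsum_eq, Summable.tsum_sum]
  · rfl
  · exact hs'.comp_injective Sum.inl_injective
  · exact hs'.comp_injective Sum.inr_injective

lemma thB_mul (x y : ℂ) {τ : ℂ} (hτ : 0 < τ.im) :
    thB (x + y) τ * thB (x - y) τ =
      thB (2 * x) (2 * τ) * jacobiTheta₂ (2 * y) (2 * τ) +
        jacobiTheta₂ (2 * x) (2 * τ) * thB (2 * y) (2 * τ) := by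
  have h := th_mul (x + τ / 2) y hτ
  rw [show x + τ / 2 + y = x + y + τ / 2 by ring, show x + τ / 2 - y = x - y + τ / 2 by ring,
    th_shift, th_shift, show 2 * (x + τ / 2) = 2 * x + 2 * τ / 2 by ring, th_shift, thB_shift,
    mul_mul_mul_comm, ← Complex.exp_add,
    show -(Real.pi * I * τ / 4 + Real.pi * I * (x + y)) +
      -(Real.pi * I * τ / 4 + Real.pi * I * (x - y)) =
      -(Real.pi * I * (2 * τ) / 4 + Real.pi * I * (2 * x)) by ring] at h
  refine mul_left_cancel₀ (Complex.exp_ne_zero _) (Eq.trans h ?_)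
  ring

lemma thS_mul (x y : ℂ) {τ : ℂ} (hτ : 0 < τ.im) :
    thB (x + y + 1 / 2) τ * thB (x - y + 1 / 2) τ =
      jacobiTheta₂ (2 * x) (2 * τ) * thB (2 * y) (2 * τ) -
      thB (2 * x) (2 * τ) * jacobiTheta₂ (2 * y) (2 * τ) := by
  have h := thB_mul (x + 1 / 2) y hτ
  rw [show x + 1 / 2 + y = x + y + 1 / 2 by ring, show x + 1 / 2 - y = x - y + 1 / 2 by ring,
    show 2 * (x + 1 / 2) = 2 * x + 1 by ring, thB_add_one, jacobiTheta₂_add_left] at h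
  rw [h]
  ring

lemma thB_half {τ : ℂ} (hτ : 0 < τ.im) : thB (1 / 2) τ = 0 := by
  have h := thS_mul 0 0 hτ
  simp only [add_zero, sub_zero, zero_add] at h
  rw [mul_comm (jacobiTheta₂ _ _), sub_self] at h
  exact mul_self_eq_zero.1 h

lemma three_term (x y z w : ℂ) {τ : ℂ} (hτ : 0 < τ.im) :
    jacobiTheta₂ (x + z) τ * jacobiTheta₂ (x - z) τ *
      (jacobiTheta₂ (y + w) τ * jacobiTheta₂ (y - w) τ) -
    jacobiTheta₂ (x + w) τ * jacobiTheta₂ (x - w) τ *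
      (jacobiTheta₂ (y + z) τ * jacobiTheta₂ (y - z) τ) =
    thB (x + y + 1 / 2) τ * thB (x - y + 1 / 2) τ *
      (thB (z + w + 1 / 2) τ * thB (z - w + 1 / 2) τ) := by
  rw [th_mul _ _ hτ, th_mul _ _ hτ, th_mul _ _ hτ, th_mul _ _ hτ, thS_mul _ _ hτ, thS_mul _ _ hτ]
  ring

lemma key_eps (e : ℂ) {τ : ℂ} (hτ : 0 < τ.im) :
    jacobiTheta₂ (1 / 3 + e) τ ^ 3 * jacobiTheta₂ e τ -
      jacobiTheta₂ (1 / 3 - e) τ ^ 3 * jacobiTheta₂ e τ =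
    thB (1 / 6) τ ^ 3 * thB (2 * e + 1 / 2) τ := by
  have h := three_term (-1 / 2) (1 / 6) (-1 / 6 + e) (-1 / 6 - e) hτ
  rw [← jacobiTheta₂_add_left (-1 / 2 + (-1 / 6 + e)), ← jacobiTheta₂_add_left (-1 / 2 + (-1 / 6 - e)),
    show -1 / 2 + (-1 / 6 + e) + 1 = 1 / 3 + e by ring,
    show -1 / 2 + (-1 / 6 - e) + 1 = 1 / 3 - e by ring,
    show -1 / 2 - (-1 / 6 + e) = -(1 / 3 + e) by ring,
    show -1 / 2 - (-1 / 6 - e) = -(1 / 3 - e) by ring,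
    show 1 / 6 + (-1 / 6 - e) = -e by ring,
    show 1 / 6 + (-1 / 6 + e) = e by ring,
    show 1 / 6 - (-1 / 6 - e) = 1 / 3 + e by ring,
    show 1 / 6 - (-1 / 6 + e) = 1 / 3 - e by ring,
    show (-1 / 2 + 1 / 6 + 1 / 2 : ℂ) = 1 / 6 by ring,
    show (-1 / 2 - 1 / 6 + 1 / 2 : ℂ) = - (1 / 6) by ring,
    show (-1 / 6 + e + (-1 / 6 - e) + 1 / 2 : ℂ) = 1 / 6 by ring,
    show (-1 / 6 + e - (-1 / 6 - e) + 1 / 2 : ℂ) = 2 * e + 1 / 2 by ring,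
    jacobiTheta₂_neg_left, jacobiTheta₂_neg_left, jacobiTheta₂_neg_left, thB_neg] at h
  linear_combination h

lemma thB_hasDerivAt {τ : ℂ} (hτ : 0 < τ.im) :
    HasDerivAt (fun z => thB (z + 1 / 2) τ)
      (I * cexp (Real.pi * I * τ / 4) * jacobiTheta₂' (1 / 2 + τ / 2) τ) 0 := by
  have h0 : jacobiTheta₂ (0 + 1 / 2 + τ / 2) τ = 0 := by
    have := thB_half hτ
    unfold thB at this
    simpa [Complex.exp_ne_zero] using this
  have h1 : HasDerivAt (fun z : ℂ => jacobiTheta₂ (z + (1 / 2 + τ / 2)) τ)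
      (jacobiTheta₂' (0 + (1 / 2 + τ / 2)) τ) 0 :=
    HasDerivAt.comp_add_const (f := fun z => jacobiTheta₂ z τ) 0 _
      (hasDerivAt_jacobiTheta₂_fst _ hτ)
  have h2 : HasDerivAt (fun z : ℂ => cexp (Real.pi * I * τ / 4 + Real.pi * I * (z + 1 / 2)))
      (cexp (Real.pi * I * τ / 4 + Real.pi * I * (0 + 1 / 2)) * (Real.pi * I * 1)) 0 :=
    ((((hasDerivAt_id (0 : ℂ)).add_const (1 / 2)).const_mul (Real.pi * I)).const_add _).cexp
  have h3 := h2.mul h1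
  have hI : cexp (Real.pi * I * τ / 4 + Real.pi * I * (0 + 1 / 2)) =
      I * cexp (Real.pi * I * τ / 4) := by
    rw [Complex.exp_add, show Real.pi * I * (0 + 1 / 2) = Real.pi / 2 * I by ring,
      Complex.exp_pi_div_two_mul_I, mul_comm]
  rw [← add_assoc (0 : ℂ), h0, hI, mul_zero, zero_add, zero_add] at h3
  refine h3.congr_of_eventuallyEq (Filter.Eventually.of_forall fun z => ?_)
  simp only [thB, Pi.mul_apply, add_assoc]

/-- derivative of the odd theta function at the origin -/
noncomputable def thD (τ : ℂ) : ℂ := I * cexp (Real.pi * I * τ / 4) * jacobiTheta₂' (1 / 2 + τ / 2) τ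

lemma key_deriv {τ : ℂ} (hτ : 0 < τ.im) :
    3 * jacobiTheta₂' (1 / 3) τ * jacobiTheta₂ (1 / 3) τ ^ 2 * jacobiTheta₂ 0 τ =
      thB (1 / 6) τ ^ 3 * thD τ := by
  have h1 : HasDerivAt (fun e : ℂ => jacobiTheta₂ (1 / 3 + e) τ) (jacobiTheta₂' (1 / 3) τ) 0 :=
    HasDerivAt.comp_const_add (f := fun z => jacobiTheta₂ z τ) (1 / 3) 0
      (by simpa using hasDerivAt_jacobiTheta₂_fst (1 / 3) hτ)
  have h2 : HasDerivAt (fun e : ℂ => jacobiTheta₂ (1 / 3 - e) τ) (- jacobiTheta₂' (1 / 3) τ) 0 :=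
    HasDerivAt.comp_const_sub (f := fun z => jacobiTheta₂ z τ) (1 / 3) 0
      (by simpa using hasDerivAt_jacobiTheta₂_fst (1 / 3) hτ)
  have h3 := hasDerivAt_jacobiTheta₂_fst 0 hτ
  have h4 : HasDerivAt (fun e : ℂ => thB (2 * e + 1 / 2) τ) (thD τ * (2 * 1)) 0 :=
    HasDerivAt.comp (h₂ := fun z => thB (z + 1 / 2) τ) (h := fun e => 2 * e) 0
      (by simpa [thD] using thB_hasDerivAt hτ) ((hasDerivAt_id (0 : ℂ)).const_mul 2)
  have hl := ((h1.pow 3).mul h3).sub ((h2.pow 3).mul h3)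
  have hr := h4.const_mul (thB (1 / 6) τ ^ 3)
  have := hl.unique (hr.congr_of_eventuallyEq (Filter.Eventually.of_forall fun e => key_eps e hτ))
  simp only [Pi.pow_apply, add_zero, sub_zero] at this
  push_cast at this
  linear_combination this / 2

lemma landen_D {τ : ℂ} (hτ : 0 < τ.im) :
    thD τ * thB 0 τ = 2 * thD (2 * τ) * jacobiTheta₂ (1 / 2) (2 * τ) := by
  have hτ2 := two_mul_im_pos hτ
  have key : ∀ z : ℂ, thB (z + 1 / 2) τ * thB 0 τ =
      2 * (thB (z + 1 / 2) (2 * τ) * jacobiTheta₂ (z + 1 / 2) (2 * τ)) := by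
    intro z
    have h := thB_mul (z / 2 + 1 / 4) (z / 2 + 1 / 4) hτ
    rw [sub_self, show z / 2 + 1 / 4 + (z / 2 + 1 / 4) = z + 1 / 2 by ring,
      show 2 * (z / 2 + 1 / 4) = z + 1 / 2 by ring] at h
    rw [h]; ring
  have h1 : HasDerivAt (fun z : ℂ => jacobiTheta₂ (z + 1 / 2) (2 * τ))
      (jacobiTheta₂' (0 + 1 / 2) (2 * τ)) 0 :=
    HasDerivAt.comp_add_const (f := fun z => jacobiTheta₂ z (2 * τ)) 0 _
      (hasDerivAt_jacobiTheta₂_fst _ hτ2)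
  have hl := (thB_hasDerivAt hτ).mul_const (thB 0 τ)
  have hr := ((thB_hasDerivAt hτ2).mul h1).const_mul 2
  have := hl.unique (hr.congr_of_eventuallyEq (Filter.Eventually.of_forall key))
  simp only [zero_add, thB_half hτ2] at this
  unfold thD
  linear_combination this

lemma landen_34 {τ : ℂ} (hτ : 0 < τ.im) :
    jacobiTheta₂ 0 τ * jacobiTheta₂ (1 / 2) τ = jacobiTheta₂ (1 / 2) (2 * τ) ^ 2 := by
  have h := th_mul (1 / 4) (1 / 4) hτ
  rw [sub_self, show (1 / 4 + 1 / 4 : ℂ) = 1 / 2 by ring, show (2 * (1 / 4) : ℂ) = 1 / 2 by ring,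
    thB_half (two_mul_im_pos hτ)] at h
  linear_combination h

lemma landen_2 {τ : ℂ} (hτ : 0 < τ.im) :
    thB 0 τ ^ 2 = 2 * (thB 0 (2 * τ) * jacobiTheta₂ 0 (2 * τ)) := by
  have h := thB_mul 0 0 hτ
  simp only [add_zero, sub_zero, mul_zero] at h
  linear_combination h

lemma lim_gen (c : ℤ → ℂ) (e : ℤ → ℤ) (he : ∀ n, 0 ≤ e n) {τ : ℂ} (hτ : 0 < τ.im)
    (hs : Summable fun n => ‖c n * cexp (Real.pi * I * e n * τ)‖) :
    Filter.Tendsto (fun k : ℕ => ∑' n, c n * cexp (Real.pi * I * e n * (2 ^ k * τ))) Filter.atTop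
      (nhds (∑' n, if e n = 0 then c n else 0)) := by
  have hnorm : ∀ (n : ℤ) (k : ℕ), ‖cexp (Real.pi * I * e n * (2 ^ k * τ))‖ =
      Real.exp (-(Real.pi * e n * τ.im) * 2 ^ k) := by
    intro n k
    rw [Complex.norm_exp]
    congr 1
    rw [show Real.pi * I * e n * (2 ^ k * τ) = ((Real.pi * e n * 2 ^ k : ℝ) : ℂ) * τ * I by
      push_cast; ring, mul_I_re, im_ofReal_mul]
    ring
  refine tendsto_tsum_of_dominated_convergence hs ?_ (Filter.Eventually.of_forall ?_)
  · intro n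
    split_ifs with h
    · simp [h]
    · have hpos : 0 < Real.pi * e n * τ.im := by
        have : (0 : ℝ) < e n := by exact_mod_cast lt_of_le_of_ne (he n) (Ne.symm h)
        positivity
      rw [← mul_zero (c n)]
      refine Filter.Tendsto.const_mul _ ?_
      rw [tendsto_zero_iff_norm_tendsto_zero]
      simp_rw [hnorm]
      refine Real.tendsto_exp_atBot.comp ?_
      exact (tendsto_pow_atTop_atTop_of_one_lt one_lt_two).const_mul_atTop_of_neg (by linarith)
  · intro k n
    have h0 := hnorm n 0
    simp only [pow_zero, one_mul, mul_one] at h0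
    rw [norm_mul, norm_mul, hnorm, h0]
    refine mul_le_mul_of_nonneg_left (Real.exp_le_exp.2 ?_) (norm_nonneg _)
    have hpos : 0 ≤ Real.pi * e n * τ.im := by
      have : (0 : ℝ) ≤ e n := by exact_mod_cast he n
      have := Real.pi_pos
      positivity
    have : (1 : ℝ) ≤ 2 ^ k := one_le_pow₀ one_le_two
    nlinarith

lemma lim_th (z : ℂ) {τ : ℂ} (hτ : 0 < τ.im) :
    Filter.Tendsto (fun k : ℕ => jacobiTheta₂ z (2 ^ k * τ)) Filter.atTop (nhds 1) := by
  have e : ∀ σ : ℂ, ∀ n : ℤ, jacobiTheta₂_term n z σ =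
      cexp (2 * Real.pi * I * n * z) * cexp (Real.pi * I * (n ^ 2 : ℤ) * σ) := by
    intro σ n
    rw [jacobiTheta₂_term, Complex.exp_add]
    push_cast
    rfl
  have h := lim_gen (fun n => cexp (2 * Real.pi * I * n * z)) (fun n => n ^ 2)
    (fun n => sq_nonneg n) hτ (by simpa only [← e] using th_summable z hτ)
  simp only [← e] at h
  have hv : (∑' n : ℤ, if n ^ 2 = 0 then cexp (2 * Real.pi * I * n * z) else 0) = 1 := by
    rw [tsum_eq_single 0]
    · simp
    · intro n hn
      simp [hn]
  rw [hv] at h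
  exact h

lemma lim_thB {τ : ℂ} (hτ : 0 < τ.im) :
    Filter.Tendsto (fun k : ℕ => jacobiTheta₂ (2 ^ k * τ / 2) (2 ^ k * τ)) Filter.atTop
      (nhds 2) := by
  have e : ∀ σ : ℂ, ∀ n : ℤ, jacobiTheta₂_term n (σ / 2) σ =
      1 * cexp (Real.pi * I * (n * (n + 1) : ℤ) * σ) := by
    intro σ n
    rw [jacobiTheta₂_term, one_mul]
    push_cast
    congr 1
    ring
  have h := lim_gen (fun n => 1) (fun n => n * (n + 1))
    (fun n => by rcases lt_or_ge n 0 with h | h <;> nlinarith) hτ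
    (by simpa only [← e] using th_summable (τ / 2) hτ)
  simp only [← e] at h
  have hv : (∑' n : ℤ, if n * (n + 1) = 0 then (1 : ℂ) else 0) = 2 := by
    rw [tsum_eq_sum (s := {0, -1})]
    · rw [Finset.sum_pair (by decide)]
      norm_num
    · intro n hn
      simp only [Finset.mem_insert, Finset.mem_singleton] at hn
      rw [if_neg]
      intro h
      rcases mul_eq_zero.1 h with h | h <;> omega
  rw [hv] at h
  exact h

lemma lim_thD {τ : ℂ} (hτ : 0 < τ.im) :
    Filter.Tendsto (fun k : ℕ => jacobiTheta₂' (1 / 2 + 2 ^ k * τ / 2) (2 ^ k * τ)) Filter.atTop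
      (nhds (2 * Real.pi * I)) := by
  have e : ∀ σ : ℂ, ∀ n : ℤ, jacobiTheta₂'_term n (1 / 2 + σ / 2) σ =
      (2 * Real.pi * I * n * cexp (Real.pi * I * n)) *
        cexp (Real.pi * I * (n * (n + 1) : ℤ) * σ) := by
    intro σ n
    rw [jacobiTheta₂'_term, jacobiTheta₂_term, mul_assoc _ (cexp _), ← Complex.exp_add]
    push_cast
    congr 2
    ring
  have h := lim_gen (fun n => 2 * Real.pi * I * n * cexp (Real.pi * I * n)) (fun n => n * (n + 1))
    (fun n => by rcases lt_or_ge n 0 with h | h <;> nlinarith) hτ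
    (by simpa only [← e] using ((summable_jacobiTheta₂'_term_iff _ _).2 hτ).norm)
  simp only [← e] at h
  have hv : (∑' n : ℤ, if n * (n + 1) = 0 then 2 * Real.pi * I * n * cexp (Real.pi * I * n) else 0) = 2 * Real.pi * I := by
    rw [tsum_eq_sum (s := {0, -1})]
    · simp [Complex.exp_neg]
    · intro n hn
      simp only [Finset.mem_insert, Finset.mem_singleton] at hn
      rw [if_neg]
      intro h
      rcases mul_eq_zero.1 h with h | h <;> omega
  rw [hv] at h
  exact h

lemma pow_im_pos {τ : ℂ} (hτ : 0 < τ.im) (k : ℕ) : 0 < (2 ^ k * τ).im := by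
  rw [show (2 ^ k * τ : ℂ) = ((2 ^ k : ℝ) : ℂ) * τ by push_cast; rfl, im_ofReal_mul]
  positivity

lemma descend (P : ℂ → Prop) (hP : ∀ σ : ℂ, 0 < σ.im → P (2 * σ) → P σ) {τ : ℂ} (hτ : 0 < τ.im)
    (h : ∀ᶠ k : ℕ in Filter.atTop, P (2 ^ k * τ)) : P τ := by
  obtain ⟨k, hk⟩ := h.exists
  induction k with
  | zero => simpa using hk
  | succ k ih =>
    refine ih (hP _ (pow_im_pos hτ k) ?_)
    rwa [← mul_assoc, ← pow_succ']

lemma th4_ne {τ : ℂ} (hτ : 0 < τ.im) : jacobiTheta₂ (1 / 2) τ ≠ 0 := by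
  refine descend (fun σ => jacobiTheta₂ (1 / 2) σ ≠ 0) ?_ hτ
    ((lim_th (1 / 2) hτ).eventually_ne one_ne_zero)
  intro σ hσ h h0
  have := landen_34 hσ
  rw [h0, mul_zero] at this
  exact h (pow_eq_zero_iff two_ne_zero |>.1 this.symm)

lemma th3_ne {τ : ℂ} (hτ : 0 < τ.im) : jacobiTheta₂ 0 τ ≠ 0 := by
  intro h0
  have := landen_34 hτ
  rw [h0, zero_mul] at this
  exact th4_ne (two_mul_im_pos hτ) (pow_eq_zero_iff two_ne_zero |>.1 this.symm)

lemma thB_ne {τ : ℂ} (hτ : 0 < τ.im) : thB 0 τ ≠ 0 := by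
  refine descend (fun σ => thB 0 σ ≠ 0) ?_ hτ ?_
  · intro σ hσ h h0
    have := landen_2 hσ
    rw [h0] at this
    have h3 := th3_ne (two_mul_im_pos hσ)
    simp_all
  · filter_upwards [(lim_thB hτ).eventually_ne two_ne_zero] with k hk
    unfold thB
    rw [zero_add]
    exact mul_ne_zero (Complex.exp_ne_zero _) hk

/-- the ratio in Jacobi's derivative formula -/
noncomputable def jacRatio (τ : ℂ) : ℂ :=
  thD τ / (thB 0 τ * jacobiTheta₂ 0 τ * jacobiTheta₂ (1 / 2) τ)

lemma jacRatio_two {τ : ℂ} (hτ : 0 < τ.im) : jacRatio (2 * τ) = jacRatio τ := by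
  have hτ2 := two_mul_im_pos hτ
  have a := landen_D hτ
  have b := landen_34 hτ
  have c := landen_2 hτ
  have h1 := thB_ne hτ
  have h2 := th3_ne hτ
  have h3 := th4_ne hτ
  have h4 := thB_ne hτ2
  have h5 := th3_ne hτ2
  have h6 := th4_ne hτ2
  unfold jacRatio
  rw [div_eq_div_iff (mul_ne_zero (mul_ne_zero h4 h5) h6) (mul_ne_zero (mul_ne_zero h1 h2) h3)]
  refine mul_left_cancel₀ (mul_ne_zero (mul_ne_zero two_ne_zero h6) h1) ?_
  calc _ = (2 * thD (2 * τ) * jacobiTheta₂ (1 / 2) (2 * τ)) * thB 0 τ ^ 2 *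
        (jacobiTheta₂ 0 τ * jacobiTheta₂ (1 / 2) τ) := by ring
    _ = _ := by rw [← a, b, c]; ring

lemma jacobi_formula {τ : ℂ} (hτ : 0 < τ.im) :
    thD τ = - Real.pi * thB 0 τ * jacobiTheta₂ 0 τ * jacobiTheta₂ (1 / 2) τ := by
  have hc : ∀ k : ℕ, jacRatio (2 ^ k * τ) = jacRatio τ := by
    intro k
    induction k with
    | zero => simp
    | succ k ih => rw [pow_succ', mul_assoc, jacRatio_two (pow_im_pos hτ k), ih]
  have hl := ((lim_thD hτ).const_mul I).div (((lim_thB hτ).mul (lim_th 0 hτ)).mul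
    (lim_th (1 / 2) hτ)) (by norm_num)
  have hr : jacRatio τ = I * (2 * Real.pi * I) / (2 * 1 * 1) := by
    refine tendsto_nhds_unique (tendsto_const_nhds.congr fun k => ?_) hl
    rw [← hc k]
    unfold jacRatio thD thB
    rw [mul_zero, add_zero, zero_add, mul_comm I, mul_assoc, mul_assoc (cexp _), mul_assoc (cexp _),
      mul_div_mul_left _ _ (Complex.exp_ne_zero _)]
    simp
  unfold jacRatio at hr
  rw [div_eq_iff (mul_ne_zero (mul_ne_zero (thB_ne hτ) (th3_ne hτ)) (th4_ne hτ))] at hr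
  rw [hr]
  linear_combination (Real.pi * thB 0 τ * jacobiTheta₂ 0 τ * jacobiTheta₂ (1 / 2) τ) * I_sq

lemma charDeriv_zero (ε : ℝ) {τ : ℂ} (hτ : 0 < τ.im) :
    jacobiThetaCharDeriv 0 ε τ = jacobiTheta₂' ε τ := by
  unfold jacobiThetaCharDeriv
  simp only [char_zero]
  have : HasDerivAt (fun z : ℂ => jacobiTheta₂ (z + ε) τ) (jacobiTheta₂' (0 + ε) τ) 0 :=
    HasDerivAt.comp_add_const (f := fun z => jacobiTheta₂ z τ) 0 _
      (hasDerivAt_jacobiTheta₂_fst _ hτ)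
  rw [this.deriv, zero_add]

/-- `θ'[0;1/3](0,τ) · θ[0;1/3](0,τ)² = −(π/3) θ[1/2;0](0,τ) θ[0;1/2](0,τ) θ[1/2;1/6](0,τ)³`. -/
theorem theta_derivative_third (τ : ℂ) (hτ : 0 < τ.im) :
    jacobiThetaCharDeriv 0 (1 / 3) τ * jacobiThetaChar 0 (1 / 3) 0 τ ^ 2 =
      -((Real.pi : ℂ) / 3) * jacobiThetaChar (1 / 2) 0 0 τ *
        jacobiThetaChar 0 (1 / 2) 0 τ * jacobiThetaChar (1 / 2) (1 / 6) 0 τ ^ 3 := by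
  rw [charDeriv_zero _ hτ, char_zero, char_zero, char_half, char_half]
  push_cast
  simp only [zero_add]
  have h := key_deriv hτ
  rw [jacobi_formula hτ] at h
  refine mul_left_cancel₀ (th3_ne hτ) ?_
  linear_combination h / 3
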